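/- If the Riemann zeta function has a nontrivial zero s₀ off the critical line, and the function E(s) = 1/s lies in the closed linear span in the Hardy space H²({Re s > 1/2}) of the functions F_λ(s) = (λ^s - λ)·ζ(s)/s for 0 ≤ λ ≤ 1, then one gets a contradiction; i.e., if E is in that closed span, the Riemann Hypothesis holds. -/

import Mathlib

open Real Complex Filter Finset

/-- The (squared) Hardy-space `H²` norm on the half-plane `{Re s > 1/2}`:
`‖F‖² = sup_{σ > 1/2} (1/2π) ∫ |F(σ + it)|² dt`. -/
noncomputable def hardyNormSq (F : ℂ → ℂ) : ℝ :=
  ⨆ σ : {σ : ℝ // 1 / 2 < σ}, (1 / (2 * π)) * ∫ t : ℝ, ‖F (σ.1 + t * Complex.I)‖ ^ 2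

/-- The function `F_λ(s) = (λ^s - λ) ζ(s) / s`. -/
noncomputable def Flam (lam : ℝ) (s : ℂ) : ℂ :=
  ((lam : ℂ) ^ s - (lam : ℂ)) * riemannZeta s / s

open MeasureTheory FourierTransform SchwartzMap in
theorem plancherel_aux (k : ℝ → ℂ) (h1 : Integrable k) (h2 : MemLp k 2) :
    ∫ t, ‖𝓕 k t‖ ^ 2 = ∫ u, ‖k u‖ ^ 2 := by
  set f : Lp (α := ℝ) ℂ 2 volume := h2.toLp k with hf
  have hcont : Continuous (𝓕 k) :=
    VectorFourier.fourierIntegral_continuous Real.continuous_fourierChar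
      (by exact continuous_inner) h1
  have hae : ∀ᵐ x, (𝓕 f : Lp (α := ℝ) ℂ 2 volume) x = 𝓕 k x := by
    apply ae_eq_of_integral_contDiff_smul_eq
    · exact (Lp.memLp _).locallyIntegrable (by norm_num)
    · exact hcont.locallyIntegrable
    · intro g hg hgc
      have hg2 : ContDiff ℝ (⊤ : ℕ∞) (fun x => (g x : ℂ)) :=
        Complex.ofRealCLM.contDiff.comp hg
      have hgc2 : HasCompactSupport (fun x => (g x : ℂ)) := hgc.comp_left (g := Complex.ofReal) rfl
      set φ : 𝓢(ℝ, ℂ) := hgc2.toSchwartzMap hg2 with hφ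
      have e := congrArg (fun T => T φ) (Lp.fourier_toTemperedDistribution_eq f)
      simp only [TemperedDistribution.fourier_apply, Lp.toTemperedDistribution_apply] at e
      have e1 : ∫ x, (𝓕 φ) x • f x = ∫ x, (𝓕 φ) x • k x := by
        apply integral_congr_ae
        filter_upwards [h2.coeFn_toLp] with x hx
        rw [hf, hx]
      have e2 : ∫ x, (𝓕 φ) x • k x = ∫ x, φ x • 𝓕 k x := by
        have := VectorFourier.integral_fourierIntegral_smul_eq_flip (μ := volume) (ν := volume)
          (L := innerₗ ℝ) (f := (φ : ℝ → ℂ)) (g := k) (e := Real.fourierChar)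
          Real.continuous_fourierChar (by exact continuous_inner) φ.integrable h1
        rw [flip_innerₗ] at this
        exact this
      rw [e1, e2] at e
      exact e.symm
  have hn := Lp.norm_fourier_eq f
  have key : ∀ (F : Lp (α := ℝ) ℂ 2 volume), ∫ x, ‖F x‖ ^ 2 = ‖F‖ ^ 2 := by
    intro F
    have h3 := inner_self_eq_norm_sq_to_K (𝕜 := ℂ) F
    rw [L2.inner_def] at h3
    simp only [inner_self_eq_norm_sq_to_K] at h3
    have h4 : (∫ x, ((‖F x‖ : ℝ) : ℂ) ^ 2) = ((∫ x, ‖F x‖ ^ 2 : ℝ) : ℂ) := by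
      rw [← integral_complex_ofReal]; simp
    have h5 : ((∫ x, ‖F x‖ ^ 2 : ℝ) : ℂ) = ((‖F‖ ^ 2 : ℝ) : ℂ) := by
      rw [← h4]; simpa using h3
    exact_mod_cast h5
  calc ∫ t, ‖𝓕 k t‖ ^ 2 = ∫ t, ‖(𝓕 f : Lp (α := ℝ) ℂ 2 volume) t‖ ^ 2 := by
        apply integral_congr_ae
        filter_upwards [hae] with x hx
        rw [hx]
    _ = ∫ t, ‖f t‖ ^ 2 := by rw [key, key, hn]
    _ = _ := by
        apply integral_congr_ae
        filter_upwards [h2.coeFn_toLp] with x hx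
        rw [hf, hx]

structure NiceFn (h : ℝ → ℂ) : Prop where
  meas : Measurable h
  bdd : ∃ M : ℝ, 0 ≤ M ∧ ∀ x, ‖h x‖ ≤ M
  supp : ∀ x, 1 < x → h x = 0

noncomputable def kfun (h : ℝ → ℂ) (σ : ℝ) (u : ℝ) : ℂ :=
  Real.exp (-σ * u) • h (Real.exp (-u))

theorem kfun_meas {h : ℝ → ℂ} (hh : NiceFn h) (σ : ℝ) : Measurable (kfun h σ) := by
  unfold kfun
  have := hh.meas
  fun_prop

theorem exp_ind_integrable {σ : ℝ} (hσ : 0 < σ) (M : ℝ) :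
    MeasureTheory.Integrable
      (Set.indicator (Set.Ici (0:ℝ)) (fun u => M * Real.exp (-σ * u))) := by
  rw [MeasureTheory.integrable_indicator_iff measurableSet_Ici, integrableOn_Ici_iff_integrableOn_Ioi]
  exact (integrableOn_exp_mul_Ioi (by linarith) 0).const_mul M

theorem exp_ind_integral {σ : ℝ} (hσ : 0 < σ) (M : ℝ) :
    ∫ u, (Set.indicator (Set.Ici (0:ℝ)) (fun u => M * Real.exp (-σ * u))) u = M / σ := by
  rw [MeasureTheory.integral_indicator measurableSet_Ici, MeasureTheory.integral_Ici_eq_integral_Ioi,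
    MeasureTheory.integral_const_mul, integral_exp_mul_Ioi (by linarith)]
  simp
  field_simp

theorem kfun_bound {h : ℝ → ℂ} (hh : NiceFn h) {M : ℝ} (hM : ∀ x, ‖h x‖ ≤ M) (σ u : ℝ) :
    ‖kfun h σ u‖ ≤ Set.indicator (Set.Ici (0:ℝ)) (fun u => M * Real.exp (-σ * u)) u := by
  unfold kfun
  by_cases hu : 0 ≤ u
  · rw [Set.indicator_of_mem (by exact hu), norm_smul, mul_comm, Real.norm_eq_abs, abs_of_pos (Real.exp_pos _)]
    exact mul_le_mul_of_nonneg_right (hM _) (Real.exp_pos _).le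
  · rw [Set.indicator_of_notMem (by exact hu), hh.supp _ (by rw [Real.one_lt_exp_iff]; linarith)]
    simp

theorem kfun_integrable {h : ℝ → ℂ} (hh : NiceFn h) {σ : ℝ} (hσ : 0 < σ) :
    MeasureTheory.Integrable (kfun h σ) := by
  obtain ⟨M, hM0, hM⟩ := hh.bdd
  exact (exp_ind_integrable hσ M).mono' (kfun_meas hh σ).aestronglyMeasurable
    (.of_forall (kfun_bound hh hM σ))

theorem kfun_sq_bound {h : ℝ → ℂ} (hh : NiceFn h) {M : ℝ} (hM : ∀ x, ‖h x‖ ≤ M) (σ u : ℝ) :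
    ‖kfun h σ u‖ ^ 2 ≤
      Set.indicator (Set.Ici (0:ℝ)) (fun u => M ^ 2 * Real.exp (-(2 * σ) * u)) u := by
  have := pow_le_pow_left₀ (norm_nonneg _) (kfun_bound hh hM σ u) 2
  refine this.trans (le_of_eq ?_)
  by_cases hu : 0 ≤ u
  · rw [Set.indicator_of_mem (by exact hu), Set.indicator_of_mem (by exact hu), mul_pow,
      ← Real.exp_nat_mul]
    congr 2; push_cast; ring
  · rw [Set.indicator_of_notMem (by exact hu), Set.indicator_of_notMem (by exact hu)]; simp

theorem kfun_sq_integrable {h : ℝ → ℂ} (hh : NiceFn h) {σ : ℝ} (hσ : 0 < σ) :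
    MeasureTheory.Integrable (fun u => ‖kfun h σ u‖ ^ 2) := by
  obtain ⟨M, hM0, hM⟩ := hh.bdd
  refine (exp_ind_integrable (σ := 2 * σ) (by linarith) (M ^ 2)).mono'
    ((kfun_meas hh σ).norm.pow_const 2).aestronglyMeasurable (.of_forall fun u => ?_)
  rw [Real.norm_of_nonneg (by positivity)]
  exact kfun_sq_bound hh hM σ u

theorem kfun_memLp {h : ℝ → ℂ} (hh : NiceFn h) {σ : ℝ} (hσ : 0 < σ) :
    MeasureTheory.MemLp (kfun h σ) 2 :=
  (MeasureTheory.memLp_two_iff_integrable_sq_norm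
    (kfun_meas hh σ).aestronglyMeasurable).2 (kfun_sq_integrable hh hσ)

theorem line_integral {h : ℝ → ℂ} (hh : NiceFn h) {H : ℂ → ℂ}
    (hH : ∀ s : ℂ, 1 / 2 < s.re → s ≠ 1 → H s = mellin h s) {σ : ℝ} (hσ : 1 / 2 < σ) :
    (1 / (2 * π)) * ∫ t : ℝ, ‖H (σ + t * Complex.I)‖ ^ 2 = ∫ u, ‖kfun h σ u‖ ^ 2 := by
  have e : ∫ t : ℝ, ‖H (σ + t * Complex.I)‖ ^ 2 =
      ∫ t : ℝ, (fun y => ‖FourierTransform.fourier (kfun h σ) y‖ ^ 2) (t / (2 * π)) := by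
    apply MeasureTheory.integral_congr_ae
    have : ∀ᵐ t : ℝ, t ≠ 0 := by
      simp [MeasureTheory.ae_iff]
    filter_upwards [this] with t ht
    rw [hH _ (by simpa using hσ) (fun hc => ht (by simpa using congrArg Complex.im hc)),
      mellin_eq_fourier]
    simp only [add_re, ofReal_re, mul_re, I_re, mul_zero, ofReal_im, I_im, mul_one, sub_self,
      add_zero, add_im, mul_im, zero_add]
    rfl
  rw [e, MeasureTheory.Measure.integral_comp_div (fun y => ‖FourierTransform.fourier (kfun h σ) y‖ ^ 2) (2 * π),
    plancherel_aux _ (kfun_integrable hh (by linarith)) (kfun_memLp hh (by linarith)),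
    abs_of_pos (by positivity), smul_eq_mul]
  field_simp

theorem le_hardy {h : ℝ → ℂ} (hh : NiceFn h) {H : ℂ → ℂ}
    (hH : ∀ s : ℂ, 1 / 2 < s.re → s ≠ 1 → H s = mellin h s) {σ : ℝ} (hσ : 1 / 2 < σ) :
    ∫ u, ‖kfun h σ u‖ ^ 2 ≤ hardyNormSq H := by
  obtain ⟨M, hM0, hM⟩ := hh.bdd
  rw [← line_integral hh hH hσ]
  refine le_ciSup (f := fun σ : {σ : ℝ // 1 / 2 < σ} =>
    (1 / (2 * π)) * ∫ t : ℝ, ‖H (σ.1 + t * Complex.I)‖ ^ 2) ?_ ⟨σ, hσ⟩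
  refine ⟨M ^ 2, ?_⟩
  rintro _ ⟨⟨τ, hτ⟩, rfl⟩
  simp only
  rw [line_integral hh hH hτ]
  calc _ ≤ ∫ u, Set.indicator (Set.Ici (0:ℝ)) (fun u => M ^ 2 * Real.exp (-(2 * τ) * u)) u :=
        MeasureTheory.integral_mono (kfun_sq_integrable hh (by linarith))
          (exp_ind_integrable (by linarith) _) (kfun_sq_bound hh hM τ)
    _ = M ^ 2 / (2 * τ) := exp_ind_integral (by linarith) _
    _ ≤ M ^ 2 := div_le_self (by positivity) (by linarith)

/-- Point evaluation is continuous. -/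
theorem point_eval {h : ℝ → ℂ} (hh : NiceFn h) {H : ℂ → ℂ}
    (hH : ∀ s : ℂ, 1 / 2 < s.re → s ≠ 1 → H s = mellin h s) {s₀ : ℂ} (hs : 1 / 2 < s₀.re)
    (hs1 : s₀ ≠ 1) :
    ‖H s₀‖ ^ 2 ≤ hardyNormSq H * (1 / (s₀.re - 1 / 2)) := by
  set σ := (s₀.re + 1 / 2) / 2 with hσd
  set δ := (s₀.re - 1 / 2) / 2 with hδd
  have hσ : 1 / 2 < σ := by linarith
  have hδ : 0 < δ := by linarith
  have hsum : s₀.re = σ + δ := by rw [hσd, hδd]; ring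
  have hle := le_hardy hh hH hσ
  have b1 : ‖H s₀‖ ≤ ∫ u, ‖kfun h s₀.re u‖ := by
    rw [hH _ hs hs1, mellin_eq_fourier]
    exact VectorFourier.norm_fourierIntegral_le_integral_norm _ _ _ _ _
  have b2 : ∀ u, ‖kfun h s₀.re u‖ =
      ‖kfun h σ u‖ * Set.indicator (Set.Ici (0:ℝ)) (fun u => 1 * Real.exp (-δ * u)) u := by
    intro u
    unfold kfun
    by_cases hu : 0 ≤ u
    · rw [Set.indicator_of_mem (by exact hu), norm_smul, norm_smul, Real.norm_eq_abs,
        Real.norm_eq_abs, abs_of_pos (Real.exp_pos _), abs_of_pos (Real.exp_pos _), hsum,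
        show -(σ + δ) * u = -σ * u + -δ * u by ring, Real.exp_add]
      ring
    · rw [Set.indicator_of_notMem (by exact hu), hh.supp _ (by rw [Real.one_lt_exp_iff]; linarith)]
      simp
  set e : ℝ → ℝ := Set.indicator (Set.Ici (0:ℝ)) (fun u => 1 * Real.exp (-δ * u)) with he
  have e0 : ∀ u, 0 ≤ e u := fun u => Set.indicator_nonneg (fun x _ => by positivity) u
  have esq : ∀ u, e u ^ 2 = Set.indicator (Set.Ici (0:ℝ)) (fun u => 1 * Real.exp (-(2 * δ) * u)) u := by
    intro u
    by_cases hu : 0 ≤ u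
    · rw [he, Set.indicator_of_mem (by exact hu), Set.indicator_of_mem (by exact hu), one_mul,
        one_mul, ← Real.exp_nat_mul]
      congr 1; push_cast; ring
    · rw [he, Set.indicator_of_notMem (by exact hu), Set.indicator_of_notMem (by exact hu)]; simp
  have eint : ∫ u, e u ^ 2 = 1 / (2 * δ) := by
    simp_rw [esq]; exact exp_ind_integral (by linarith) _
  have eL : MeasureTheory.MemLp e 2 := by
    refine (MeasureTheory.memLp_two_iff_integrable_sq
      (exp_ind_integrable hδ 1).aestronglyMeasurable).2 ?_
    exact (exp_ind_integrable (σ := 2 * δ) (by linarith) 1).congr (.of_forall fun u => (esq u).symm)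
  have cs := MeasureTheory.integral_mul_le_Lp_mul_Lq_of_nonneg (μ := MeasureTheory.volume)
    (f := fun u => ‖kfun h σ u‖) (g := e) (p := 2) (q := 2) ⟨by norm_num, by norm_num, by norm_num⟩
    (.of_forall fun u => norm_nonneg _) (.of_forall e0)
    (by simpa using (kfun_memLp hh (σ := σ) (by linarith)).norm) (by simpa using eL)
  simp only [Real.rpow_two, eint] at cs
  simp_rw [b2] at b1
  have b3 := b1.trans cs
  have hI : 0 ≤ ∫ u, ‖kfun h σ u‖ ^ 2 := MeasureTheory.integral_nonneg fun u => by positivity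
  calc ‖H s₀‖ ^ 2 ≤ _ := pow_le_pow_left₀ (norm_nonneg _) b3 2
    _ = (∫ u, ‖kfun h σ u‖ ^ 2) * (1 / (2 * δ)) := by
      rw [mul_pow, ← Real.sqrt_eq_rpow, ← Real.sqrt_eq_rpow, Real.sq_sqrt hI,
        Real.sq_sqrt (by positivity)]
    _ ≤ hardyNormSq H * (1 / (2 * δ)) := by gcongr
    _ = _ := by rw [hδd]; congr 2; ring


/-- `⌊1/x⌋`. -/
noncomputable def Pfun (x : ℝ) : ℂ := (⌊x⁻¹⌋₊ : ℂ)

noncomputable def gfun (lam : ℝ) (x : ℝ) : ℂ := (⌊lam * x⁻¹⌋₊ : ℂ) - lam * (⌊x⁻¹⌋₊ : ℂ)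

theorem gfun_nice {lam : ℝ} (h0 : 0 ≤ lam) (h1 : lam ≤ 1) : NiceFn (gfun lam) where
  meas := by
    unfold gfun
    have hc : Measurable (fun n : ℕ => (n : ℂ)) := measurable_from_top
    exact (hc.comp (Nat.measurable_floor.comp (by fun_prop))).sub
      ((hc.comp (Nat.measurable_floor.comp (by fun_prop))).const_mul _)
  bdd := by
    refine ⟨1, zero_le_one, fun x => ?_⟩
    have e : gfun lam x = (((⌊lam * x⁻¹⌋₊ : ℝ) - lam * (⌊x⁻¹⌋₊ : ℝ) : ℝ) : ℂ) := by
      simp [gfun]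
    rw [e, Complex.norm_real, Real.norm_eq_abs]
    rcases le_or_gt x 0 with hx | hx
    · have hx' : x⁻¹ ≤ 0 := inv_nonpos.2 hx
      rw [Nat.floor_of_nonpos hx', Nat.floor_of_nonpos (mul_nonpos_of_nonneg_of_nonpos h0 hx')]
      simp
    · have hy : 0 ≤ x⁻¹ := (inv_pos.2 hx).le
      have a1 := Nat.floor_le hy
      have a2 := Nat.lt_floor_add_one x⁻¹
      have a3 := Nat.floor_le (mul_nonneg h0 hy)
      have a4 := Nat.lt_floor_add_one (lam * x⁻¹)
      rw [abs_le]
      constructor <;> nlinarith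
  supp := by
    intro x hx
    have hy : x⁻¹ < 1 := inv_lt_one_of_one_lt₀ hx
    have hy0 : 0 < x⁻¹ := by positivity
    have : lam * x⁻¹ < 1 := by nlinarith
    simp [gfun, Nat.floor_eq_zero.2 hy, Nat.floor_eq_zero.2 this]

theorem ind_nice : NiceFn (Set.indicator (Set.Ioc 0 1) (fun _ => 1)) where
  meas := measurable_const.indicator measurableSet_Ioc
  bdd := ⟨1, zero_le_one, fun x => by
    refine (norm_indicator_le_norm_self _ _).trans ?_; simp⟩
  supp := fun x hx => Set.indicator_of_notMem (fun h => by linarith [h.2]) _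

theorem NiceFn.const_mul {h : ℝ → ℂ} (hh : NiceFn h) (c : ℂ) : NiceFn (fun x => c * h x) where
  meas := hh.meas.const_mul c
  bdd := by
    obtain ⟨M, h0, hM⟩ := hh.bdd
    exact ⟨‖c‖ * M, by positivity, fun x => by rw [norm_mul]; gcongr; exact hM x⟩
  supp := fun x hx => by simp [hh.supp x hx]

theorem NiceFn.sub {h g : ℝ → ℂ} (hh : NiceFn h) (hg : NiceFn g) :
    NiceFn (fun x => h x - g x) where
  meas := hh.meas.sub hg.meas
  bdd := by
    obtain ⟨M, h0, hM⟩ := hh.bdd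
    obtain ⟨N, h0', hN⟩ := hg.bdd
    exact ⟨M + N, by positivity, fun x => (norm_sub_le _ _).trans (add_le_add (hM x) (hN x))⟩
  supp := fun x hx => by simp [hh.supp x hx, hg.supp x hx]

theorem NiceFn.sum {n : ℕ} {h : Fin n → ℝ → ℂ} (hh : ∀ i, NiceFn (h i)) :
    NiceFn (fun x => ∑ i, h i x) where
  meas := Finset.measurable_sum _ fun i _ => (hh i).meas
  bdd := by
    choose M h0 hM using fun i => (hh i).bdd
    exact ⟨∑ i, M i, Finset.sum_nonneg fun i _ => h0 i,
      fun x => (norm_sum_le _ _).trans (Finset.sum_le_sum fun i _ => hM i x)⟩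
  supp := fun x hx => Finset.sum_eq_zero fun i _ => (hh i).supp x hx

theorem NiceFn.locInt {h : ℝ → ℂ} (hh : NiceFn h) :
    MeasureTheory.LocallyIntegrableOn h (Set.Ioi 0) := by
  obtain ⟨M, h0, hM⟩ := hh.bdd
  refine ((MeasureTheory.locallyIntegrable_const M).locallyIntegrableOn _).mono
    hh.meas.aestronglyMeasurable (.of_forall fun x => ?_)
  rw [Real.norm_of_nonneg h0]; exact hM x

theorem isBigO_top_of_supp {h : ℝ → ℂ} (hs : ∀ x, 1 < x → h x = 0) (a : ℝ) :
    h =O[atTop] (fun x : ℝ => x ^ (-a)) := by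
  refine (Asymptotics.isBigO_zero (E' := ℂ) _ _).congr' ?_ .rfl
  filter_upwards [eventually_gt_atTop 1] with x hx
  exact (hs x hx).symm

theorem NiceFn.isBigO_bot {h : ℝ → ℂ} (hh : NiceFn h) :
    h =O[nhdsWithin 0 (Set.Ioi 0)] (fun x : ℝ => x ^ (-(0:ℝ))) := by
  obtain ⟨M, h0, hM⟩ := hh.bdd
  refine Asymptotics.IsBigO.of_bound M (.of_forall fun x => ?_)
  simpa using hM x

theorem NiceFn.conv {h : ℝ → ℂ} (hh : NiceFn h) {s : ℂ} (hs : 0 < s.re) :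
    MellinConvergent h s :=
  mellinConvergent_of_isBigO_rpow hh.locInt (isBigO_top_of_supp hh.supp (s.re + 1)) (by linarith)
    hh.isBigO_bot hs

theorem NiceFn.diff {h : ℝ → ℂ} (hh : NiceFn h) {s : ℂ} (hs : 0 < s.re) :
    DifferentiableAt ℂ (mellin h) s :=
  mellin_differentiableAt_of_isBigO_rpow hh.locInt (isBigO_top_of_supp hh.supp (s.re + 1))
    (by linarith) hh.isBigO_bot hs

theorem Pfun_conv {s : ℂ} (hs : 1 < s.re) : MellinConvergent Pfun s := by
  have hle : ∀ x : ℝ, ‖Pfun x‖ ≤ ‖x⁻¹‖ := by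
    intro x
    rw [Pfun, Complex.norm_natCast, Real.norm_eq_abs]
    rcases le_or_gt x 0 with hx | hx
    · rw [Nat.floor_of_nonpos (inv_nonpos.2 hx)]; simp
    · exact (Nat.floor_le (inv_pos.2 hx).le).trans (le_abs_self _)
  refine mellinConvergent_of_isBigO_rpow (a := s.re + 1) (b := 1) ?_
    (isBigO_top_of_supp (fun x hx => ?_) _) (by linarith) ?_ hs
  · have : MeasureTheory.LocallyIntegrableOn (fun x : ℝ => x⁻¹) (Set.Ioi 0) :=
      ContinuousOn.locallyIntegrableOn
        (continuousOn_inv₀.mono fun x hx => ne_of_gt hx) measurableSet_Ioi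
    refine this.mono ?_ (.of_forall hle)
    have hc : Measurable (fun n : ℕ => (n : ℂ)) := measurable_from_top
    exact (hc.comp (Nat.measurable_floor.comp (by fun_prop))).aestronglyMeasurable
  · have hy : x⁻¹ < 1 := inv_lt_one_of_one_lt₀ hx
    simp [Pfun, Nat.floor_eq_zero.2 hy]
  · refine Asymptotics.IsBigO.of_bound 1 (.of_forall fun x => ?_)
    rw [one_mul, Real.rpow_neg_one]
    exact hle x

theorem Pfun_mellin {s : ℂ} (hs : 1 < s.re) : mellin Pfun s = riemannZeta s / s := by
  have hs0 : s ≠ 0 := by rintro rfl; norm_num at hs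
  have h1 := LSeries_eq_mul_integral' (1 : ℕ → ℂ) zero_le_one hs (by
    refine Asymptotics.IsBigO.of_bound 1 (.of_forall fun n => ?_)
    simp)
  rw [LSeries_one_eq_riemannZeta hs] at h1
  rw [h1, mul_div_cancel_left₀ _ hs0]
  have h2 := mellin_comp_inv (fun t : ℝ => (⌊t⌋₊ : ℂ)) s
  have h3 : mellin Pfun s = mellin (fun t : ℝ => (⌊t⌋₊ : ℂ)) (-s) := h2
  rw [h3, mellin]
  rw [MeasureTheory.setIntegral_eq_of_subset_of_ae_sdiff_eq_zero (s := Set.Ioi 1) (t := Set.Ioi 0)]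
  · apply MeasureTheory.setIntegral_congr_fun measurableSet_Ioi
    intro t ht
    simp [mul_comm, sub_eq_add_neg, add_comm]
  · exact measurableSet_Ioi.nullMeasurableSet
  · exact Set.Ioi_subset_Ioi zero_le_one
  · have : ∀ᵐ t : ℝ, t ≠ 1 := by simp [MeasureTheory.ae_iff]
    filter_upwards [this] with t h1 ht
    have : t < 1 := lt_of_le_of_ne (not_lt.1 ht.2) h1
    simp [Nat.floor_eq_zero.2 this]

theorem gfun_mellin_aux {lam : ℝ} (h0 : 0 < lam) {s : ℂ} (hs : 1 < s.re) :
    mellin (gfun lam) s = ((lam : ℂ) ^ s - lam) * riemannZeta s / s := by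
  have hl : 0 < lam⁻¹ := inv_pos.2 h0
  have hs0 : s ≠ 0 := by rintro rfl; norm_num at hs
  have c1 := (MellinConvergent.comp_mul_left (f := Pfun) (s := s) hl).2 (Pfun_conv hs)
  have c2 := (Pfun_conv hs).const_smul (lam : ℂ)
  have e := (hasMellin_sub c1 c2).2
  have e' : gfun lam = fun t => Pfun (lam⁻¹ * t) - (lam : ℂ) • Pfun t := by
    funext t; simp [gfun, Pfun, mul_comm]
  rw [e', e, mellin_comp_mul_left _ _ hl, mellin_const_smul, Pfun_mellin hs, Complex.ofReal_inv,
    Complex.inv_cpow _ _ (by rw [Complex.arg_ofReal_of_nonneg h0.le]; exact Real.pi_pos.ne),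
    Complex.cpow_neg, inv_inv]
  simp only [smul_eq_mul]
  ring

theorem gfun_mellin {lam : ℝ} (h0 : 0 ≤ lam) (h1 : lam ≤ 1) {s : ℂ} (hs : 0 < s.re) (hs1 : s ≠ 1) :
    Flam lam s = mellin (gfun lam) s := by
  have hs0 : s ≠ 0 := by rintro rfl; norm_num at hs
  rcases h0.eq_or_lt with rfl | hpos
  · have : gfun 0 = fun _ => 0 := by funext x; simp [gfun]
    rw [this]
    simp [Flam, mellin, Complex.zero_cpow hs0]
  set U : Set ℂ := {z | 0 < z.re} with hU
  have hUo : IsOpen U := isOpen_lt continuous_const Complex.continuous_re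
  have hUc : IsPreconnected U := (convex_halfSpace_re_gt 0).isPreconnected
  have hn := gfun_nice h0 h1
  have A : AnalyticOnNhd ℂ (fun z => (z - 1) * z * mellin (gfun lam) z) U :=
    DifferentiableOn.analyticOnNhd (fun z hz => by
      have := hn.diff hz
      exact DifferentiableAt.differentiableWithinAt (by fun_prop)) hUo
  have B : AnalyticOnNhd ℂ (fun z => ((lam : ℂ) ^ z - lam) * riemannZeta₁ z) U :=
    DifferentiableOn.analyticOnNhd (fun z hz => by
      have : DifferentiableAt ℂ (fun z => (lam : ℂ) ^ z) z :=
        differentiableAt_id.const_cpow (Or.inl (by exact_mod_cast hpos.ne'))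
      exact DifferentiableAt.differentiableWithinAt (by fun_prop)) hUo
  have hz1 : ∀ z : ℂ, z ≠ 1 → riemannZeta₁ z = (z - 1) * riemannZeta z := by
    intro z hz
    have := sub_ne_zero.2 hz
    rw [riemannZeta_eq_inv_sub_mul hz]; field_simp
  have E := A.eqOn_of_preconnected_of_eventuallyEq B hUc (z₀ := 2) (by simp [hU]) (by
    have : {z : ℂ | 1 < z.re} ∈ nhds (2 : ℂ) :=
      (isOpen_lt continuous_const Complex.continuous_re).mem_nhds (by simp)
    filter_upwards [this] with z hz
    have z0 : z ≠ 0 := by rintro rfl; norm_num at hz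
    have z1 : z ≠ 1 := by rintro rfl; norm_num at hz
    rw [gfun_mellin_aux hpos hz, hz1 z z1]
    field_simp)
  have := E (show s ∈ U from hs)
  simp only [hz1 s hs1] at this
  have s1 := sub_ne_zero.2 hs1
  rw [Flam, div_eq_iff hs0]
  apply mul_left_cancel₀ s1
  linear_combination -this

theorem comb_mellin {n : ℕ} (c : Fin n → ℂ) (lam : Fin n → ℝ) (hl : ∀ i, 0 ≤ lam i ∧ lam i ≤ 1) :
    ∃ h : ℝ → ℂ, NiceFn h ∧ ∀ s : ℂ, 1 / 2 < s.re → s ≠ 1 →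
      1 / s - ∑ i, c i * Flam (lam i) s = mellin h s := by
  have hg := fun i => (gfun_nice (hl i).1 (hl i).2).const_mul (c i)
  refine ⟨_, ind_nice.sub (NiceFn.sum hg), fun s hs hs1 => ?_⟩
  have hs0 : 0 < s.re := by linarith
  rw [(hasMellin_sub (ind_nice.conv hs0) ((NiceFn.sum hg).conv hs0)).2,
    (hasMellin_one_Ioc hs0).2]
  congr 1
  simp only [mellin, Finset.smul_sum]
  rw [MeasureTheory.integral_finsetSum _ fun i _ => (hg i).conv hs0]
  refine Finset.sum_congr rfl fun i _ => ?_
  rw [gfun_mellin (hl i).1 (hl i).2 hs0 hs1]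
  exact (mellin_const_smul (gfun (lam i)) s (c i)).symm
theorem zero_reflect {s : ℂ} (hz : riemannZeta s = 0) (ht : ¬∃ n : ℕ, s = -2 * (n + 1))
    (hs1 : s ≠ 1) : riemannZeta (1 - s) = 0 := by
  have hn : ∀ n : ℕ, s ≠ -n := by
    rintro n rfl
    rcases Nat.even_or_odd n with he | ho
    · obtain ⟨m, rfl⟩ := he
      rcases m with _ | m
      · simp [riemannZeta_zero] at hz
      · exact ht ⟨m, by push_cast; ring⟩
    · obtain ⟨m, rfl⟩ := ho
      have e := riemannZeta_one_sub (s := ((2 * m + 1 : ℕ) : ℂ) + 1) (fun k hk => by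
          have := congrArg Complex.re hk
          simp at this
          have h1 : (0:ℝ) ≤ m := Nat.cast_nonneg _
          have h2 : (0:ℝ) ≤ k := Nat.cast_nonneg _
          linarith) (by
          intro hk
          have := congrArg Complex.re hk
          simp at this
          have h1 : (0:ℝ) ≤ m := Nat.cast_nonneg _
          linarith)
      rw [show (1:ℂ) - (((2 * m + 1 : ℕ) : ℂ) + 1) = -((2 * m + 1 : ℕ) : ℂ) by ring, hz] at e
      have g : Complex.Gamma (((2 * m + 1 : ℕ) : ℂ) + 1) ≠ 0 := by
        rw [Complex.Gamma_nat_eq_factorial]; exact_mod_cast Nat.factorial_ne_zero _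
      have z : riemannZeta (((2 * m + 1 : ℕ) : ℂ) + 1) ≠ 0 :=
        riemannZeta_ne_zero_of_one_le_re (by simp; positivity)
      have co : Complex.cos (π * (((2 * m + 1 : ℕ) : ℂ) + 1) / 2) ≠ 0 := by
        rw [show (π * (((2 * m + 1 : ℕ) : ℂ) + 1) / 2) = ((m + 1 : ℕ) : ℂ) * π by push_cast; ring,
          show Complex.cos (((m + 1 : ℕ) : ℂ) * π) = (-1) ^ (m + 1) by
            exact_mod_cast congrArg Complex.ofReal (Real.cos_nat_mul_pi (m + 1))]
        exact pow_ne_zero _ (by norm_num)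
      have p : (2 * (π : ℂ)) ^ (-(((2 * m + 1 : ℕ) : ℂ) + 1)) ≠ 0 := by
        rw [Complex.cpow_ne_zero_iff]
        left
        exact mul_ne_zero two_ne_zero (by exact_mod_cast Real.pi_pos.ne')
      exact mul_ne_zero (mul_ne_zero (mul_ne_zero (mul_ne_zero two_ne_zero p) g) co) z e.symm
  rw [riemannZeta_one_sub hn hs1, hz, mul_zero]

theorem no_zero_right
    (h : ∀ ε > (0 : ℝ), ∃ (n : ℕ) (c : Fin n → ℂ) (lam : Fin n → ℝ),
      (∀ i, 0 ≤ lam i ∧ lam i ≤ 1) ∧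
      hardyNormSq (fun s => 1 / s - ∑ i, c i * Flam (lam i) s) < ε)
    {s : ℂ} (hs : 1 / 2 < s.re) (hs1 : s ≠ 1) (hz : riemannZeta s = 0) : False := by
  have hs0 : s ≠ 0 := by rintro rfl; norm_num at hs
  have hd : 0 < s.re - 1 / 2 := by linarith
  have hpos : 0 < ‖1 / s‖ ^ 2 := pow_pos (norm_pos_iff.2 (one_div_ne_zero hs0)) 2
  obtain ⟨n, c, lam, hl, hlt⟩ := h (‖1 / s‖ ^ 2 * (s.re - 1 / 2)) (by positivity)
  obtain ⟨g, hg, hm⟩ := comb_mellin c lam hl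
  have key := point_eval hg hm hs hs1
  have e : (1 / s - ∑ i, c i * Flam (lam i) s) = 1 / s := by
    simp [Flam, hz]
  simp only [e] at key
  rw [mul_one_div, le_div_iff₀ hd] at key
  linarith


/-- If `E(s) = 1/s` belongs to the closed linear span (in the Hardy space
`H²({Re s > 1/2})`) of the functions `F_λ`, `0 ≤ λ ≤ 1`, then the
Riemann Hypothesis holds. -/
theorem riemannHypothesis_of_mem_closedSpan
    (h : ∀ ε > (0 : ℝ), ∃ (n : ℕ) (c : Fin n → ℂ) (lam : Fin n → ℝ),
      (∀ i, 0 ≤ lam i ∧ lam i ≤ 1) ∧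
      hardyNormSq (fun s => 1 / s - ∑ i, c i * Flam (lam i) s) < ε) :
    RiemannHypothesis := by
  intro s hz ht hs1
  by_contra hne
  rcases lt_or_gt_of_ne hne with hlt | hgt
  · have hz' := zero_reflect hz ht hs1
    refine no_zero_right h (s := 1 - s) (by simp; linarith) (fun hc => ?_) hz'
    have : s = 0 := by linear_combination -hc
    rw [this, riemannZeta_zero] at hz
    norm_num at hz
  · exact no_zero_right h hgt hs1 hz
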